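/- Let 𝒫 be a finite nonempty set of N×N real row-stochastic matrices, each irreducible with strictly positive diagonal entries, and let (W_i)_{i≥1} be any sequence of elements of 𝒫 with left products W^{(t)} = W_t W_{t−1} ⋯ W_1. Then there exists a probability vector π_∞ ∈ ℝ^N (nonnegative entries summing to 1) such that W^{(t)} converges entrywise, as t → ∞, to the rank-one matrix 𝟙 π_∞ᵀ, i.e. W^{(t)}_{ij} → π_∞(j) for all i, j. -/

import Mathlib

open Matrix BigOperators Filter

/-- A square real matrix is row-stochastic if all entries are nonnegative and
every row sums to `1`. -/
def RowStochastic {N : ℕ} (A : Matrix (Fin N) (Fin N) ℝ) : Prop :=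
  (∀ i j, 0 ≤ A i j) ∧ ∀ i, ∑ j, A i j = 1

/-- A (nonnegative) square matrix is irreducible if for every pair of indices
`i, j` some power `n ≥ 1` of the matrix has a strictly positive `(i,j)` entry. -/
def IrredMat {N : ℕ} (A : Matrix (Fin N) (Fin N) ℝ) : Prop :=
  ∀ i j, ∃ n : ℕ, 1 ≤ n ∧ 0 < (A ^ n) i j

/-- The MDT operator of length `t` for the sequence `W₁, W₂, …`: the left product
`W^{(t)} = W t * W (t-1) * ⋯ * W 1` (with `W^{(0)} = 1`). -/
def MDTprod {N : ℕ} (W : ℕ → Matrix (Fin N) (Fin N) ℝ) : ℕ → Matrix (Fin N) (Fin N) ℝ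
  | 0 => 1
  | t + 1 => W (t + 1) * MDTprod W t

section

variable {N : ℕ}

theorem RowStochastic.mulVec_le {A : Matrix (Fin N) (Fin N) ℝ} (hA : RowStochastic A)
    {x : Fin N → ℝ} {M : ℝ} (hx : ∀ i, x i ≤ M) (i : Fin N) : (A *ᵥ x) i ≤ M := by
  calc ∑ j, A i j * x j ≤ ∑ j, A i j * M :=
        Finset.sum_le_sum fun j _ => mul_le_mul_of_nonneg_left (hx j) (hA.1 i j)
    _ = M := by rw [← Finset.sum_mul, hA.2 i, one_mul]

theorem RowStochastic.le_mulVec {A : Matrix (Fin N) (Fin N) ℝ} (hA : RowStochastic A)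
    {x : Fin N → ℝ} {m : ℝ} (hx : ∀ i, m ≤ x i) (i : Fin N) : m ≤ (A *ᵥ x) i := by
  calc m = ∑ j, A i j * m := by rw [← Finset.sum_mul, hA.2 i, one_mul]
    _ ≤ ∑ j, A i j * x j :=
        Finset.sum_le_sum fun j _ => mul_le_mul_of_nonneg_left (hx j) (hA.1 i j)

/-- A weight of at least `ε` on an entry lying `δ` below the upper bound `M` lowers the average
by at least `ε * δ`. -/
theorem RowStochastic.mulVec_le_sub {A : Matrix (Fin N) (Fin N) ℝ} (hA : RowStochastic A)
    {x : Fin N → ℝ} {M ε δ : ℝ} (hx : ∀ i, x i ≤ M) (hδ : 0 ≤ δ) {i j : Fin N}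
    (hε : ε ≤ A i j) (hj : x j ≤ M - δ) : (A *ᵥ x) i ≤ M - ε * δ := by
  have h₁ : A i j * (M - x j) ≤ ∑ k, A i k * (M - x k) :=
    Finset.single_le_sum (f := fun k => A i k * (M - x k))
      (fun k _ => mul_nonneg (hA.1 i k) (sub_nonneg.2 (hx k))) (Finset.mem_univ j)
  have h₂ : ∑ k, A i k * (M - x k) = M - (A *ᵥ x) i := by
    simp only [mul_sub, Finset.sum_sub_distrib, ← Finset.sum_mul, hA.2 i, one_mul]
    rfl
  have h₃ : ε * δ ≤ A i j * (M - x j) :=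
    mul_le_mul hε (by linarith) hδ (hA.1 i j)
  linarith

/-- An irreducible nonnegative matrix has a positive entry leading from the complement of any
nontrivial set of indices into that set. -/
theorem IrredMat.exists_pos_of_notMem_of_mem {A : Matrix (Fin N) (Fin N) ℝ}
    (hirr : IrredMat A) (hA : ∀ i j, 0 ≤ A i j) {S : Finset (Fin N)} (hS : S.Nonempty)
    (hS' : S ≠ Finset.univ) : ∃ i ∉ S, ∃ j ∈ S, 0 < A i j := by
  by_contra! h
  have key : ∀ n : ℕ, ∀ i ∉ S, ∀ j ∈ S, (A ^ n) i j = 0 := by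
    intro n
    induction n with
    | zero =>
      intro i hi j hj
      rw [pow_zero, Matrix.one_apply_ne (by rintro rfl; exact hi hj)]
    | succ n ih =>
      intro i hi j hj
      rw [pow_succ', Matrix.mul_apply]
      refine Finset.sum_eq_zero fun k _ => ?_
      by_cases hk : k ∈ S
      · rw [le_antisymm (h i hi k hk) (hA i k), zero_mul]
      · rw [ih k hk j hj, mul_zero]
  obtain ⟨j, hj⟩ := hS
  obtain ⟨i, hi⟩ : ∃ i, i ∉ S := by
    by_contra! h'
    exact hS' (Finset.eq_univ_iff_forall.2 h')
  obtain ⟨n, -, hn⟩ := hirr i j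
  exact hn.ne' (key n i hi j hj)

/-- Finitely many matrices admit a common positive lower bound for their positive entries. -/
theorem exists_pos_le_of_pos_entry (P : Finset (Matrix (Fin N) (Fin N) ℝ)) :
    ∃ ε : ℝ, 0 < ε ∧ ∀ A ∈ P, ∀ i j, 0 < A i j → ε ≤ A i j := by
  let T : Set ℝ := {r | 0 < r ∧ ∃ A ∈ P, ∃ i j, A i j = r}
  have hT : T.Finite := by
    have : (⋃ A ∈ P, ⋃ i, Set.range (A i)).Finite :=
      P.finite_toSet.biUnion fun A _ => Set.finite_iUnion fun i => Set.finite_range _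
    refine this.subset ?_
    rintro r ⟨-, A, hA, i, j, rfl⟩
    simp only [Set.mem_iUnion]
    exact ⟨A, hA, i, j, rfl⟩
  rcases T.eq_empty_or_nonempty with h | h
  · refine ⟨1, one_pos, fun A hA i j hij => ?_⟩
    have : A i j ∈ T := ⟨hij, A, hA, i, j, rfl⟩
    simp [h] at this
  · obtain ⟨ε, hε, hmin⟩ := T.exists_min_image id hT h
    exact ⟨ε, hε.1, fun A hA i j hij => hmin _ ⟨hij, A, hA, i, j, rfl⟩⟩

section Consensus

variable {W : ℕ → Matrix (Fin N) (Fin N) ℝ} {x : ℕ → Fin N → ℝ} {ε : ℝ}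

/-- After `k` steps at least `k + 1` entries have moved below the initial upper bound. -/
theorem exists_finset_card_of_irredMat (hW : ∀ t, RowStochastic (W t))
    (hdiag : ∀ t i, 0 < W t i i) (hirr : ∀ t, IrredMat (W t)) (hε : 0 < ε)
    (hentry : ∀ t i j, 0 < W t i j → ε ≤ W t i j) (hx : ∀ t, x (t + 1) = W t *ᵥ x t)
    {M δ : ℝ} (hδ : 0 ≤ δ) {t : ℕ} (hM : ∀ i, x t i ≤ M) {i₀ : Fin N} (hi₀ : x t i₀ ≤ M - δ)
    (k : ℕ) : (∀ i, x (t + k) i ≤ M) ∧ ∃ S : Finset (Fin N), min N (k + 1) ≤ S.card ∧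
      ∀ i ∈ S, x (t + k) i ≤ M - ε ^ k * δ := by
  induction k with
  | zero => exact ⟨hM, {i₀}, by simp, by simpa using hi₀⟩
  | succ k ih =>
    obtain ⟨hM', S, hcard, hS⟩ := ih
    rw [← add_assoc, hx]
    refine ⟨(hW _).mulVec_le hM', ?_⟩
    have hδ' : 0 ≤ ε ^ k * δ := by positivity
    have step : ∀ i, ∀ j ∈ S, 0 < W (t + k) i j →
        (W (t + k) *ᵥ x (t + k)) i ≤ M - ε ^ (k + 1) * δ := by
      intro i j hj hij
      have := (hW _).mulVec_le_sub hM' hδ' (hentry _ i j hij) (hS j hj)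
      rwa [← mul_assoc, ← pow_succ'] at this
    by_cases hu : S = Finset.univ
    · refine ⟨S, ?_, fun i hi => step i i hi (hdiag _ i)⟩
      rw [hu, Finset.card_univ, Fintype.card_fin]
      exact min_le_left _ _
    · have hpos : 0 < N := i₀.pos
      have hne : S.Nonempty := Finset.card_pos.1 (by omega)
      obtain ⟨i, hi, j, hj, hij⟩ := (hirr (t + k)).exists_pos_of_notMem_of_mem (hW _).1 hne hu
      refine ⟨insert i S, ?_, ?_⟩
      · rw [Finset.card_insert_of_notMem hi]
        omega
      · intro l hl
        rcases Finset.mem_insert.1 hl with rfl | hl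
        · exact step l j hj hij
        · exact step l l hl (hdiag _ l)

/-- Iterated averaging with irreducible stochastic matrices of positive diagonal, whose positive
entries are bounded away from zero, reaches consensus. -/
theorem exists_tendsto_of_irredMat [Nonempty (Fin N)] (hW : ∀ t, RowStochastic (W t))
    (hdiag : ∀ t i, 0 < W t i i) (hirr : ∀ t, IrredMat (W t)) (hε : 0 < ε)
    (hentry : ∀ t i j, 0 < W t i j → ε ≤ W t i j) (hx : ∀ t, x (t + 1) = W t *ᵥ x t) :
    ∃ c : ℝ, ∀ i, Tendsto (fun t => x t i) atTop (nhds c) := by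
  set M : ℕ → ℝ := fun t => ⨆ i, x t i
  set m : ℕ → ℝ := fun t => ⨅ i, x t i
  have hxM : ∀ t i, x t i ≤ M t := fun t i => le_ciSup (Set.finite_range _).bddAbove i
  have hmx : ∀ t i, m t ≤ x t i := fun t i => ciInf_le (Set.finite_range _).bddBelow i
  have hanti : Antitone M := antitone_nat_of_succ_le fun t =>
    ciSup_le fun i => by rw [hx]; exact (hW t).mulVec_le (hxM t) i
  have hmono : Monotone m := monotone_nat_of_le_succ fun t =>
    le_ciInf fun i => by rw [hx]; exact (hW t).le_mulVec (hmx t) i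
  have hmM : ∀ t, m t ≤ M t := fun t =>
    (hmx t (Classical.arbitrary _)).trans (hxM t _)
  have hM : Tendsto M atTop (nhds (⨅ t, M t)) := tendsto_atTop_ciInf hanti
    ⟨m 0, by rintro _ ⟨t, rfl⟩; exact (hmono t.zero_le).trans (hmM t)⟩
  have hm : Tendsto m atTop (nhds (⨆ t, m t)) := tendsto_atTop_ciSup hmono
    ⟨M 0, by rintro _ ⟨t, rfl⟩; exact (hmM t).trans (hanti t.zero_le)⟩
  have hcontr : ∀ t, M (t + N) ≤ M t - ε ^ N * (M t - m t) := by
    intro t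
    obtain ⟨i₀, hi₀⟩ := exists_eq_ciInf_of_finite (f := x t)
    obtain ⟨-, S, hcard, hS⟩ := exists_finset_card_of_irredMat hW hdiag hirr hε hentry hx
      (sub_nonneg.2 (hmM t)) (hxM t) (i₀ := i₀) (by rw [hi₀, sub_sub_cancel]) N
    have hu : S = Finset.univ := Finset.eq_univ_of_card S (by
      have := S.card_le_univ
      rw [Fintype.card_fin] at this ⊢
      omega)
    exact ciSup_le fun i => hS i (hu ▸ Finset.mem_univ i)
  have hlim := le_of_tendsto_of_tendsto' (hM.comp (tendsto_add_atTop_nat N))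
    (hM.sub ((hM.sub hm).const_mul (ε ^ N))) hcontr
  have hle : (⨆ t, m t) ≤ ⨅ t, M t := le_of_tendsto_of_tendsto' hm hM hmM
  have heq : (⨆ t, m t) = ⨅ t, M t := by
    have := pow_pos hε N
    nlinarith
  exact ⟨⨅ t, M t, fun i => tendsto_of_tendsto_of_tendsto_of_le_of_le (heq ▸ hm) hM
    (fun t => hmx t i) (fun t => hxM t i)⟩

end Consensus

theorem RowStochastic.mdtProd {W : ℕ → Matrix (Fin N) (Fin N) ℝ}
    (hW : ∀ t, RowStochastic (W (t + 1))) (t : ℕ) : RowStochastic (MDTprod W t) := by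
  induction t with
  | zero =>
    refine ⟨fun i j => ?_, fun i => by simp [MDTprod, Matrix.one_apply]⟩
    simp only [MDTprod, Matrix.one_apply]
    split_ifs <;> norm_num
  | succ t ih =>
    refine ⟨fun i j => ?_, fun i => ?_⟩
    · rw [MDTprod, Matrix.mul_apply]
      exact Finset.sum_nonneg fun k _ => mul_nonneg ((hW t).1 i k) (ih.1 k j)
    · simp only [MDTprod, Matrix.mul_apply]
      rw [Finset.sum_comm]
      simp only [← Finset.mul_sum, ih.2, mul_one, (hW t).2]

end

/-- For any sequence drawn from a finite nonempty set of row-stochastic, irreducible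
matrices with strictly positive diagonals, the left products `W^{(t)} = W_t ⋯ W_1`
converge entrywise to a rank-one matrix `𝟙 π_∞ᵀ` for some probability vector `π_∞`:
`W^{(t)}_{ij} → π_∞(j)` for all `i, j`. -/
theorem MDT_tendsto_rankOne {N : ℕ} (hN : 0 < N)
    (Pset : Finset (Matrix (Fin N) (Fin N) ℝ)) (hne : Pset.Nonempty)
    (hPset : ∀ A ∈ Pset, RowStochastic A ∧ (∀ i, 0 < A i i) ∧ IrredMat A)
    (W : ℕ → Matrix (Fin N) (Fin N) ℝ)
    (hW : ∀ i, 1 ≤ i → W i ∈ Pset) :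
    ∃ π : Fin N → ℝ,
      (∀ k, 0 ≤ π k) ∧ (∑ k, π k = 1) ∧
      ∀ i j, Tendsto (fun t => MDTprod W t i j) atTop (nhds (π j)) := by
  have : Nonempty (Fin N) := ⟨⟨0, hN⟩⟩
  obtain ⟨ε, hε, hentry⟩ := exists_pos_le_of_pos_entry Pset
  have hmem : ∀ t, W (t + 1) ∈ Pset := fun t => hW _ (Nat.le_add_left 1 t)
  have hcol : ∀ j, ∃ c : ℝ, ∀ i, Tendsto (fun t => MDTprod W t i j) atTop (nhds c) := fun j =>
    exists_tendsto_of_irredMat (W := fun t => W (t + 1)) (x := fun t i => MDTprod W t i j)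
      (fun t => (hPset _ (hmem t)).1) (fun t => (hPset _ (hmem t)).2.1)
      (fun t => (hPset _ (hmem t)).2.2) hε (fun t => hentry _ (hmem t)) fun t => rfl
  choose π hπ using hcol
  have hprod := RowStochastic.mdtProd fun t => (hPset _ (hmem t)).1
  refine ⟨π, fun k => ge_of_tendsto' (hπ k ⟨0, hN⟩) fun t => (hprod t).1 _ _, ?_,
    fun i j => hπ j i⟩
  have hsum := tendsto_finsetSum Finset.univ fun j _ => hπ j ⟨0, hN⟩
  simp only [(hprod _).2] at hsum
  exact tendsto_nhds_unique hsum tendsto_const_nhds
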